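/- On the hexagonal lattice with L ≥ 8: if a configuration σ ∈ X has an a-cross for some a ∈ Ω, then Σ_{b ∈ Ω∖{a}} ‖σ‖_b ≤ H(σ)²/6, where ‖σ‖_b denotes the number of sites of Λ with spin b in σ. -/

import Mathlib

open scoped Classical BigOperators

namespace IsingHex

/-- Sites of the hexagonal lattice of side length `L` with periodic boundary conditions,
identified with the `2L²` triangular faces of the dual triangular lattice `Λ*`:
`(p, false)` is the up-triangle and `(p, true)` the down-triangle in the rhombic cell `p`. -/
abbrev Site (L : ℕ) : Type := (ZMod L × ZMod L) × Bool

/-- Spin configurations `X = Ω^Λ` with spin set `Ω = Fin q`. -/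
abbrev Conf (L q : ℕ) : Type := Site L → Fin q

/-- Adjacency of the hexagonal lattice: the up-triangle `(p, false)` is adjacent to the
down-triangles `(p, true)`, `(p - (1,0), true)` and `(p - (0,1), true)`. -/
def hexAdj {L : ℕ} (v w : Site L) : Prop :=
  (v.2 = false ∧ w.2 = true ∧
     (w.1 = v.1 ∨ w.1 = (v.1.1 - 1, v.1.2) ∨ w.1 = (v.1.1, v.1.2 - 1))) ∨
  (v.2 = true ∧ w.2 = false ∧
     (v.1 = w.1 ∨ v.1 = (w.1.1 - 1, w.1.2) ∨ v.1 = (w.1.1, w.1.2 - 1)))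

/-- The Hamiltonian `H(σ)`: the number of edges of `Λ` whose endpoints carry different
spins; each edge is counted exactly once through its unique up-triangle endpoint. -/
noncomputable def Ham (L q : ℕ) (σ : Conf L q) : ℕ :=
  Nat.card {e : Site L × Site L // e.1.2 = false ∧ hexAdj e.1 e.2 ∧ σ e.1 ≠ σ e.2}

/-- The monochromatic ground state `𝐚`. -/
def groundConf (L q : ℕ) (a : Fin q) : Conf L q := fun _ => a

/-- The set `S = {𝟏, …, 𝐪}` of ground states. -/
def groundSet (L q : ℕ) : Set (Conf L q) := {σ | ∃ a : Fin q, σ = groundConf L q a}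

/-- Partition function `Z_β`. -/
noncomputable def Zfun (L q : ℕ) (β : ℝ) : ℝ :=
  ∑' σ : Conf L q, Real.exp (-β * (Ham L q σ : ℝ))

/-- Gibbs measure of a set of configurations. -/
noncomputable def gibbsP (L q : ℕ) (β : ℝ) (A : Set (Conf L q)) : ℝ :=
  (∑' σ : Conf L q, A.indicator (fun ζ => Real.exp (-β * (Ham L q ζ : ℝ))) σ) / Zfun L q β

/-- `σ ∼ ζ`: the two configurations differ at exactly one site. -/
def oneFlip {L q : ℕ} (σ ζ : Conf L q) : Prop :=
  ∃ x : Site L, σ x ≠ ζ x ∧ ∀ y : Site L, y ≠ x → σ y = ζ y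

/-- Metropolis jump rates `c_β(σ, ζ)`. -/
noncomputable def rate (L q : ℕ) (β : ℝ) (σ ζ : Conf L q) : ℝ :=
  if oneFlip σ ζ then Real.exp (-β * max ((Ham L q ζ : ℝ) - (Ham L q σ : ℝ)) 0) else 0

/-- There is a `t`-path of single spin flips connecting `σ` and `ζ`. -/
def ConnBelow (L q : ℕ) (t : ℕ) (σ ζ : Conf L q) : Prop :=
  ∃ (N : ℕ) (ω : ℕ → Conf L q), ω 0 = σ ∧ ω N = ζ ∧
    (∀ n < N, oneFlip (ω n) (ω (n + 1))) ∧ ∀ n ≤ N, Ham L q (ω n) ≤ t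

/-- Communication height `Φ(σ, ζ)`. -/
noncomputable def commHeight (L q : ℕ) (σ ζ : Conf L q) : ℕ :=
  sInf {t : ℕ | ConnBelow L q t σ ζ}

/-- The strip of index `ℓ` in direction `d` (`0` = horizontal, `1` = vertical,
`2` = diagonal): `2L` consecutive triangles winding around the torus. -/
def stripSet (L : ℕ) (d : Fin 3) (ℓ : ZMod L) : Set (Site L) :=
  if d = 0 then {v | v.1.2 = ℓ}
  else if d = 1 then {v | v.1.1 = ℓ}
  else {v | (v.2 = false ∧ v.1.1 + v.1.2 = ℓ) ∨ (v.2 = true ∧ v.1.1 + v.1.2 = ℓ - 1)}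

/-- Strip energy `ΔH_s(σ)`: number of adjacent pairs inside the strip with different spins. -/
noncomputable def stripEnergy (L q : ℕ) (σ : Conf L q) (d : Fin 3) (ℓ : ZMod L) : ℕ :=
  Nat.card {e : Site L × Site L //
    e.1.2 = false ∧ e.1 ∈ stripSet L d ℓ ∧ e.2 ∈ stripSet L d ℓ ∧
      hexAdj e.1 e.2 ∧ σ e.1 ≠ σ e.2}

/-- The strip `(d, ℓ)` is an `a`-bridge of `σ`. -/
def IsBridgeWith (L q : ℕ) (σ : Conf L q) (d : Fin 3) (ℓ : ZMod L) (a : Fin q) : Prop :=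
  ∀ v ∈ stripSet L d ℓ, σ v = a

/-- The strip `(d, ℓ)` is a bridge of `σ`. -/
def IsBridge (L q : ℕ) (σ : Conf L q) (d : Fin 3) (ℓ : ZMod L) : Prop :=
  ∃ a : Fin q, IsBridgeWith L q σ d ℓ a

/-- Cyclic enumeration of the strip `(d, ℓ)` by `ZMod (2L)`, consecutive triangles
being adjacent. -/
def stripCycle (L : ℕ) (d : Fin 3) (ℓ : ZMod L) (k : ZMod (2 * L)) : Site L :=
  let t : ZMod L := ((k.val / 2 : ℕ) : ZMod L)
  if d = 0 then ((t, ℓ), decide (k.val % 2 = 1))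
  else if d = 1 then ((ℓ, t), decide (k.val % 2 = 1))
  else if k.val % 2 = 1 then ((t, ℓ - 1 - t), true) else ((t, ℓ - t), false)

/-- A set of triangles is an arc (a set of consecutive triangles) of the strip `(d, ℓ)`. -/
def IsArc (L : ℕ) (d : Fin 3) (ℓ : ZMod L) (S : Set (Site L)) : Prop :=
  ∃ (s : ZMod (2 * L)) (m : ℕ),
    S = (fun k : ℕ => stripCycle L d ℓ (s + (k : ZMod (2 * L)))) '' Set.Iio m

/-- The strip `(d, ℓ)` is an `{a,b}`-semibridge of `σ`: it carries exactly the two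
spins `a ≠ b`, and the sites carrying each spin are consecutive in the strip. -/
def IsSemibridgePair (L q : ℕ) (σ : Conf L q) (d : Fin 3) (ℓ : ZMod L) (a b : Fin q) : Prop :=
  a ≠ b ∧ (∀ v ∈ stripSet L d ℓ, σ v = a ∨ σ v = b) ∧
    (∃ v ∈ stripSet L d ℓ, σ v = a) ∧ (∃ v ∈ stripSet L d ℓ, σ v = b) ∧
    IsArc L d ℓ {v ∈ stripSet L d ℓ | σ v = a} ∧ IsArc L d ℓ {v ∈ stripSet L d ℓ | σ v = b}

/-- The strip `(d, ℓ)` is a semibridge of `σ`. -/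
def IsSemibridge (L q : ℕ) (σ : Conf L q) (d : Fin 3) (ℓ : ZMod L) : Prop :=
  ∃ a b : Fin q, IsSemibridgePair L q σ d ℓ a b

/-- `σ` has an `a`-cross: two `a`-bridges in different directions. -/
def HasCross (L q : ℕ) (σ : Conf L q) (a : Fin q) : Prop :=
  ∃ (d d' : Fin 3) (ℓ ℓ' : ZMod L),
    d ≠ d' ∧ IsBridgeWith L q σ d ℓ a ∧ IsBridgeWith L q σ d' ℓ' a

/-- `σ` is cross-free. -/
def CrossFree (L q : ℕ) (σ : Conf L q) : Prop := ∀ a : Fin q, ¬ HasCross L q σ a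

/-- Connected subsets of the torus `𝕋_L` of strip indices (the collection `𝔖_L`). -/
def CircConn (L : ℕ) (P : Set (ZMod L)) : Prop :=
  ∀ x ∈ P, ∀ y ∈ P, ∃ (N : ℕ) (γ : ℕ → ZMod L), γ 0 = x ∧ γ N = y ∧
    (∀ n ≤ N, γ n ∈ P) ∧ ∀ n < N, γ (n + 1) = γ n + 1 ∨ γ (n + 1) = γ n - 1

/-- Union of the strips with indices in `P`, in direction `d`. -/
def stripUnion (L : ℕ) (d : Fin 3) (P : Set (ZMod L)) : Set (Site L) :=
  ⋃ ℓ ∈ P, stripSet L d ℓ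

/-- The configuration `ξ^{a,b}_U`: spin `b` on `U` and spin `a` elsewhere. -/
noncomputable def xiConf (L q : ℕ) (a b : Fin q) (U : Set (Site L)) : Conf L q :=
  fun v => if v ∈ U then b else a

/-- `σ ∈ R_n^{a,b}`: a regular configuration between `𝐚` and `𝐛` built from `n` strips. -/
def IsRegular (L q : ℕ) (σ : Conf L q) (a b : Fin q) (n : ℕ) : Prop :=
  ∃ (d : Fin 3) (P : Set (ZMod L)), CircConn L P ∧ P.ncard = n ∧
    σ = xiConf L q a b (stripUnion L d P)

/-- The vertices (in the triangular lattice) of the triangle `v`. -/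
def triVerts (L : ℕ) (v : Site L) : Set (ZMod L × ZMod L) :=
  if v.2 = false then {v.1, (v.1.1 + 1, v.1.2), (v.1.1, v.1.2 + 1)}
  else {(v.1.1 + 1, v.1.2), (v.1.1, v.1.2 + 1), (v.1.1 + 1, v.1.2 + 1)}

/-- A connected set of triangles (connected through shared sides). -/
def ConnSet (L : ℕ) (U : Set (Site L)) : Prop :=
  ∀ x ∈ U, ∀ y ∈ U, ∃ (N : ℕ) (γ : ℕ → Site L), γ 0 = x ∧ γ N = y ∧
    (∀ n ≤ N, γ n ∈ U) ∧ ∀ n < N, hexAdj (γ n) (γ (n + 1))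

/-- A one-dimensional canonical set inside the strip `(d, ℓ)`. -/
def OneDimCanonical (L : ℕ) (d : Fin 3) (ℓ : ZMod L) (U : Set (Site L)) : Prop :=
  U ⊆ stripSet L d ℓ ∧ U.Nonempty ∧ U ≠ stripSet L d ℓ ∧
  (ConnSet L U ∨
    (Even U.ncard ∧ ∃ (U₁ : Set (Site L)) (y : Site L),
      U = U₁ ∪ {y} ∧ y ∉ U₁ ∧ U₁.Nonempty ∧ ConnSet L U₁ ∧
      (∀ x ∈ U₁, ¬ hexAdj x y) ∧ ∃ x ∈ U₁, (triVerts L x ∩ triVerts L y).Nonempty))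

/-- `P ≺ P'`: connected index sets with `P ⊆ P'` and `|P'| = |P| + 1`. -/
def StepPair (L : ℕ) (P P' : Set (ZMod L)) : Prop :=
  CircConn L P ∧ CircConn L P' ∧ P ⊆ P' ∧ P'.ncard = P.ncard + 1

/-- A protuberance attached to `s(P)` inside the strip `(d, ℓ)`: a one-dimensional
canonical set such that, when `1 ≤ |P| ≤ L-2`, at least half of its triangles share a
side with `s(P)`. -/
def IsProtuberance (L : ℕ) (d : Fin 3) (P : Set (ZMod L)) (ℓ : ZMod L)
    (U : Set (Site L)) : Prop :=
  OneDimCanonical L d ℓ U ∧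
    (1 ≤ P.ncard → P.ncard ≤ L - 2 →
      U.ncard ≤ 2 * {x ∈ U | ∃ y ∈ stripUnion L d P, hexAdj x y}.ncard)

/-- `‖σ‖_a`: the number of sites with spin `a`. -/
noncomputable def spinCount (L q : ℕ) (σ : Conf L q) (a : Fin q) : ℕ :=
  Nat.card {x : Site L // σ x = a}

/-- `N̂(S)`: configurations connected to a ground state by a `(2L+2)`-path. -/
def NHatGround (L q : ℕ) : Set (Conf L q) :=
  {ζ | ∃ a : Fin q, ConnBelow L q (2 * L + 2) (groundConf L q a) ζ}

/-- A nice pair of configurations (relative to the partition class `A`). -/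
def NicePair (L q : ℕ) (A : Finset (Fin q)) (σ ζ : Conf L q) : Prop :=
  σ ∉ NHatGround L q ∧ ζ ∉ NHatGround L q ∧ oneFlip σ ζ ∧
    (∑ a ∈ A, spinCount L q σ a) = L ^ 2 ∧ (∑ a ∈ A, spinCount L q ζ a) = L ^ 2 - 1

/-- `u` is the vector of mean hitting times `σ ↦ E_σ[τ_A]` of the Metropolis dynamics:
it vanishes on `A` and satisfies the first-step (harmonicity) equations off `A`. -/
def IsMeanHittingTime (L q : ℕ) (β : ℝ) (A : Set (Conf L q)) (u : Conf L q → ℝ) : Prop :=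
  (∀ σ ∈ A, u σ = 0) ∧
    ∀ σ ∉ A, (∑' ζ : Conf L q, rate L q β σ ζ) * u σ =
      1 + ∑' ζ : Conf L q, rate L q β σ ζ * u ζ

/-- Gibbs weight `μ_β(σ)`. -/
noncomputable def gibbsWeight (L q : ℕ) (β : ℝ) (σ : Conf L q) : ℝ :=
  Real.exp (-β * (Ham L q σ : ℝ)) / Zfun L q β

/-- The Dirichlet form `D_β(f)`. -/
noncomputable def dirichletForm (L q : ℕ) (β : ℝ) (f : Conf L q → ℝ) : ℝ :=
  (1 / 2) * ∑' p : Conf L q × Conf L q,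
    gibbsWeight L q β p.1 * rate L q β p.1 p.2 * (f p.2 - f p.1) ^ 2

/-- `h` is the equilibrium potential `h^β_{A,B}(σ) = P_σ[τ_A < τ_B]`: it equals `1` on
`A`, `0` on `B`, and is harmonic for the Metropolis dynamics off `A ∪ B`. -/
def IsEqPotential (L q : ℕ) (β : ℝ) (A B : Set (Conf L q)) (h : Conf L q → ℝ) : Prop :=
  (∀ σ ∈ A, h σ = 1) ∧ (∀ σ ∈ B, h σ = 0) ∧
    ∀ σ, σ ∉ A → σ ∉ B → (∑' ζ : Conf L q, rate L q β σ ζ * (h σ - h ζ)) = 0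


/-- Initial segments of a finite set. -/
lemma exists_initial {α : Type*} [LinearOrder α] (A : Finset α) (t : ℕ) (ht : t ≤ A.card) :
    ∃ A' ⊆ A, A'.card = t ∧ ∀ x ∈ A', ∀ y ∈ A, y ≤ x → y ∈ A' := by
  induction t with
  | zero => exact ⟨∅, by simp, by simp, by simp⟩
  | succ t ih =>
    obtain ⟨A', h1, h2, h3⟩ := ih (by omega)
    have hne : (A \ A').Nonempty := by
      rw [← Finset.card_pos, Finset.card_sdiff_of_subset h1]; omega
    have hm := Finset.min'_mem _ hne
    set m := (A \ A').min' hne with hmdef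
    rw [Finset.mem_sdiff] at hm
    refine ⟨insert m A', ?_, ?_, ?_⟩
    · intro x hx
      rcases Finset.mem_insert.1 hx with rfl | hx
      · exact hm.1
      · exact h1 hx
    · rw [Finset.card_insert_of_notMem hm.2, h2]
    · intro x hx y hy hyx
      rcases Finset.mem_insert.1 hx with hx | hx
      · by_cases hyA : y ∈ A'
        · exact Finset.mem_insert_of_mem hyA
        · have : m ≤ y := Finset.min'_le _ _ (Finset.mem_sdiff.2 ⟨hy, hyA⟩)
          have : y = m := le_antisymm (hx ▸ hyx) this
          exact this ▸ Finset.mem_insert_self _ _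
      · exact Finset.mem_insert_of_mem (h3 x hx y hy hyx)

lemma exists_final (B : Finset ℤ) (t : ℕ) (ht : t ≤ B.card) :
    ∃ B' ⊆ B, B'.card = t ∧ ∀ x ∈ B', ∀ y ∈ B, x ≤ y → y ∈ B' := by
  have hinj : Function.Injective (fun x : ℤ => -x) := neg_injective
  obtain ⟨N, h1, h2, h3⟩ := exists_initial (B.image (fun x => -x)) t
    (by rw [Finset.card_image_of_injective _ hinj]; exact ht)
  refine ⟨N.image (fun x => -x), ?_, ?_, ?_⟩
  · intro x hx
    obtain ⟨y, hy, rfl⟩ := Finset.mem_image.1 hx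
    obtain ⟨w, hw, rfl⟩ := Finset.mem_image.1 (h1 hy)
    simpa using hw
  · rw [Finset.card_image_of_injective _ hinj, h2]
  · intro x hx y hy hxy
    obtain ⟨w, hw, rfl⟩ := Finset.mem_image.1 hx
    refine Finset.mem_image.2 ⟨-y, ?_, by simp⟩
    exact h3 w hw _ (Finset.mem_image_of_mem _ hy) (by omega)

/-- Number of pairs whose sum lies in `C`. -/
noncomputable def pairN (A B C : Finset ℤ) : ℕ :=
  ((A ×ˢ B).filter (fun p => p.1 + p.2 ∈ C)).card

lemma pairN_le (A B C : Finset ℤ) (t : ℕ) (ha : t ≤ A.card) (hb : t ≤ B.card) :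
    pairN A B C ≤ t * C.card + (A.card - t) * (B.card - t) := by
  obtain ⟨A', hA1, hA2, hA3⟩ := exists_initial A t ha
  obtain ⟨B', hB1, hB2, hB3⟩ := exists_final B t hb
  set F := (A ×ˢ B).filter (fun p : ℤ × ℤ => p.1 + p.2 ∈ C) with hF
  set Q := F.filter (fun p => p.1 ∈ A' ∨ p.2 ∈ B') with hQ
  have hsub : F ⊆ Q ∪ (A \ A') ×ˢ (B \ B') := by
    intro p hp
    have hp' := Finset.mem_product.1 (Finset.mem_filter.1 hp).1
    by_cases h : p.1 ∈ A' ∨ p.2 ∈ B'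
    · exact Finset.mem_union_left _ (Finset.mem_filter.2 ⟨hp, h⟩)
    · push Not at h
      exact Finset.mem_union_right _ (Finset.mem_product.2
        ⟨Finset.mem_sdiff.2 ⟨hp'.1, h.1⟩, Finset.mem_sdiff.2 ⟨hp'.2, h.2⟩⟩)
  have hQc : Q.card ≤ t * C.card := by
    refine Finset.card_le_mul_card_image_of_maps_to (f := fun p : ℤ × ℤ => p.1 + p.2)
      (fun p hp => (Finset.mem_filter.1 (Finset.mem_filter.1 hp).1).2) t ?_
    intro z hz
    set R := Q.filter (fun p => p.1 + p.2 = z) with hR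
    have hRm : ∀ p ∈ R, p.1 ∈ A ∧ p.2 ∈ B ∧ (p.1 ∈ A' ∨ p.2 ∈ B') ∧ p.1 + p.2 = z := by
      intro p hp
      simp only [hR, hQ, hF, Finset.mem_filter, Finset.mem_product] at hp
      tauto
    rcases R.eq_empty_or_nonempty with h0 | hne
    · rw [h0]; simp
    · obtain ⟨m, hm, hmax⟩ := R.exists_max_image (fun p => p.1) hne
      obtain ⟨m1, m2, m3, m4⟩ := hRm m hm
      rcases m3 with m3 | m3
      · rw [← hA2]
        refine Finset.card_le_card_of_injOn (fun p => p.1) ?_ ?_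
        · intro p hp
          exact hA3 _ m3 _ (hRm p hp).1 (hmax p hp)
        · intro p hp p' hp' h
          have h1 := (hRm p hp).2.2.2
          have h2 := (hRm p' hp').2.2.2
          have h : p.1 = p'.1 := h
          exact Prod.ext h (by omega)
      · rw [← hB2]
        refine Finset.card_le_card_of_injOn (fun p => p.2) ?_ ?_
        · intro p hp
          refine hB3 _ m3 _ (hRm p hp).2.1 ?_
          have := hmax p hp
          have := (hRm p hp).2.2.2
          show m.2 ≤ p.2
          omega
        · intro p hp p' hp' h
          have h1 := (hRm p hp).2.2.2
          have h2 := (hRm p' hp').2.2.2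
          have h : p.2 = p'.2 := h
          exact Prod.ext (by omega) h
  calc pairN A B C = F.card := rfl
    _ ≤ _ := Finset.card_le_card hsub
    _ ≤ _ := Finset.card_union_le _ _
    _ ≤ _ := by
      rw [Finset.card_product, Finset.card_sdiff_of_subset hA1,
        Finset.card_sdiff_of_subset (s := B') (t := B) hB1, hA2]
      have : B'.card = t := hB2
      rw [this]
      omega

lemma pairN_insert (A B C : Finset ℤ) (z : ℤ) (hz : z ∉ C) :
    pairN A B (insert z C) = pairN A B {z} + pairN A B C := by
  unfold pairN
  rw [← Finset.card_union_of_disjoint]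
  · congr 1
    ext p
    simp only [Finset.mem_filter, Finset.mem_union, Finset.mem_insert, Finset.mem_singleton]
    tauto
  · rw [Finset.disjoint_filter]
    intro p _ h1 h2
    rw [Finset.mem_singleton] at h1
    exact hz (h1 ▸ h2)

/-- The arithmetic isoperimetric inequality. -/
lemma pairN_isop (A B C D : Finset ℤ) (hD : D = C.image (fun z => z - 1)) :
    6 * (pairN A B C + pairN A B D) ≤ (A.card + B.card + C.card) ^ 2 := by
  have hDc : D.card = C.card := by
    rw [hD]; exact Finset.card_image_of_injective _ (fun x y h => by simpa using h)
  have key : ∀ t, t ≤ A.card → t ≤ B.card →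
      pairN A B C + pairN A B D ≤ 2 * (t * C.card + (A.card - t) * (B.card - t)) := by
    intro t h1 h2
    have := pairN_le A B C t h1 h2
    have := pairN_le A B D t h1 h2
    rw [hDc] at this
    omega
  by_cases c1 : A.card + B.card ≤ C.card
  · have := key 0 (by omega) (by omega)
    simp only [Nat.zero_mul, Nat.sub_zero, Nat.zero_add] at this
    zify at *
    nlinarith [sq_nonneg ((A.card : ℤ) - B.card)]
  by_cases c2 : A.card + C.card ≤ B.card
  · have := key A.card (by omega) (by omega)
    simp only [Nat.sub_self, Nat.zero_mul, Nat.add_zero] at this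
    zify at *
    nlinarith [sq_nonneg ((A.card : ℤ) - C.card)]
  by_cases c3 : B.card + C.card ≤ A.card
  · have := key B.card (by omega) (by omega)
    simp only [Nat.sub_self, Nat.mul_zero, Nat.add_zero] at this
    zify at *
    nlinarith [sq_nonneg ((B.card : ℤ) - C.card)]
  obtain ⟨t, ht⟩ : ∃ t, A.card + B.card = C.card + 2 * t ∨ A.card + B.card = C.card + 2 * t + 1 :=
    ⟨(A.card + B.card - C.card) / 2, by omega⟩
  obtain ⟨u, hu⟩ : ∃ u, A.card = t + u := ⟨A.card - t, by omega⟩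
  obtain ⟨v, hv⟩ : ∃ v, B.card = t + v := ⟨B.card - t, by omega⟩
  have k := key t (by omega) (by omega)
  have e1 : A.card - t = u := by omega
  have e2 : B.card - t = v := by omega
  rw [e1, e2] at k
  rcases ht with ht | ht
  · have hc : C.card = u + v := by omega
    rw [hc] at k
    rw [hu, hv, hc]
    zify at *
    nlinarith [sq_nonneg ((u : ℤ) - v), sq_nonneg ((u : ℤ) - t), sq_nonneg ((v : ℤ) - t)]
  · have hc : C.card + 1 = u + v := by omega
    by_cases hx : u = t + 1 ∧ v = t + 1
    · obtain ⟨rfl, rfl⟩ := hx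
      have hc' : C.card = 2 * t + 1 := by omega
      suffices hs : pairN A B C + pairN A B D ≤ 6 * t ^ 2 + 6 * t + 1 by
        rw [hu, hc', hv]; nlinarith
      by_contra hcon
      have hne : C.Nonempty := by rw [← Finset.card_pos]; omega
      set z := C.min' hne - 1 with hz
      have hzC : z ∉ C := fun h => by
        have := Finset.min'_le _ _ h
        omega
      have hzD : z ∈ D := by
        rw [hD]; exact Finset.mem_image_of_mem _ (Finset.min'_mem _ hne)
      have q1 := pairN_le A B C t (by omega) (by omega)
      have q2 := pairN_le A B D t (by omega) (by omega)
      have q3 := pairN_le A B (insert z C) t (by omega) (by omega)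
      have q4 := pairN_le A B (D.erase z) (t + 1) (by omega) (by omega)
      rw [pairN_insert _ _ _ _ hzC, Finset.card_insert_of_notMem hzC] at q3
      rw [Finset.card_erase_of_mem hzD] at q4
      have q5 := pairN_insert A B (D.erase z) z (Finset.notMem_erase _ _)
      rw [Finset.insert_erase hzD] at q5
      have e3 : A.card - (t + 1) = t := by omega
      have e4 : B.card - (t + 1) = t := by omega
      have e5 : 2 * t + 1 - 1 = 2 * t := by omega
      rw [e1, e2, hDc, hc'] at *
      rw [e3, e4, e5] at q4
      nlinarith
    · have hc' : (C.card : ℤ) = u + v - 1 := by omega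
      obtain ⟨x, hxx⟩ : ∃ x : ℤ, (u : ℤ) = t + 1 + x := ⟨u - t - 1, by ring⟩
      obtain ⟨y, hyy⟩ : ∃ y : ℤ, (v : ℤ) = t + 1 + y := ⟨v - t - 1, by ring⟩
      have hpos : 1 ≤ x ^ 2 - x * y + y ^ 2 := by
        by_contra hcon
        have h0 : x ^ 2 - x * y + y ^ 2 ≤ 0 := by omega
        have hx0 : x = 0 := by
          have : x ^ 2 ≤ 0 := by nlinarith [sq_nonneg (x - 2 * y)]
          exact pow_eq_zero_iff (two_ne_zero) |>.1 (le_antisymm this (sq_nonneg x))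
        have hy0 : y = 0 := by
          have : y ^ 2 ≤ 0 := by nlinarith [sq_nonneg (y - 2 * x)]
          exact pow_eq_zero_iff (two_ne_zero) |>.1 (le_antisymm this (sq_nonneg y))
        apply hx
        constructor <;> omega
      have kk : ((pairN A B C : ℤ) + pairN A B D) ≤ 2 * (t * C.card + u * v) := by exact_mod_cast k
      rw [hc', hxx, hyy] at kk
      have goal : 6 * ((pairN A B C : ℤ) + pairN A B D) ≤ (((t : ℤ) + u) + (t + v) + C.card) ^ 2 := by
        rw [hc', hxx, hyy]
        clear * - kk hpos
        have : (6 : ℤ) * (2 * (↑t * (↑t + 1 + x + (↑t + 1 + y) - 1) + (↑t + 1 + x) * (↑t + 1 + y)))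
          ≤ (↑t + (↑t + 1 + x) + (↑t + (↑t + 1 + y)) + (↑t + 1 + x + (↑t + 1 + y) - 1)) ^ 2 := by
          linear_combination 4 * hpos
        linarith
      rw [hu, hv]
      exact_mod_cast goal

/-- Planar triangles. -/
abbrev Pl : Type := (ℤ × ℤ) × Bool

/-- The three neighbours of a planar triangle. -/
def nb (k : Fin 3) (v : Pl) : Pl :=
  if k = 0 then (v.1, !v.2)
  else if k = 1 then (if v.2 = true then ((v.1.1 + 1, v.1.2), false) else ((v.1.1 - 1, v.1.2), true))
  else (if v.2 = true then ((v.1.1, v.1.2 + 1), false) else ((v.1.1, v.1.2 - 1), true))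

/-- The three strip coordinates of a planar triangle. -/
def crd (d : Fin 3) (v : Pl) : ℤ :=
  if d = 0 then v.1.2
  else if d = 1 then v.1.1
  else v.1.1 + v.1.2 + (if v.2 = true then 1 else 0)

/-- Boundary edges of type `k`. -/
noncomputable def bdc (V : Finset Pl) (k : Fin 3) : ℕ := (V.filter (fun v => nb k v ∉ V)).card

lemma strip_count_aux (V : Finset Pl) (c pos : Pl → ℤ) (kn : Pl → Fin 3)
    (hn : ∀ v, c (nb (kn v) v) = c v ∧ pos v < pos (nb (kn v) v)) :
    (V.image c).card ≤ (V.filter (fun v => nb (kn v) v ∉ V)).card := by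
  have : V.image c ⊆ (V.filter (fun v => nb (kn v) v ∉ V)).image c := by
    intro z hz
    obtain ⟨v0, hv0, hz0⟩ := Finset.mem_image.1 hz
    obtain ⟨m, hm, hmax⟩ := (V.filter (fun v => c v = z)).exists_max_image pos
      ⟨v0, Finset.mem_filter.2 ⟨hv0, hz0⟩⟩
    rw [Finset.mem_filter] at hm
    refine Finset.mem_image.2 ⟨m, Finset.mem_filter.2 ⟨hm.1, fun h => ?_⟩, hm.2⟩
    have h1 := hmax _ (Finset.mem_filter.2 ⟨h, (hn m).1.trans hm.2⟩)
    have h2 := (hn m).2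
    omega
  exact (Finset.card_le_card this).trans Finset.card_image_le

lemma strip_count (V : Finset Pl) (c pos : Pl → ℤ) (kn kp : Pl → Fin 3) (k1 k2 : Fin 3)
    (hn : ∀ v, c (nb (kn v) v) = c v ∧ pos v < pos (nb (kn v) v))
    (hp : ∀ v, c (nb (kp v) v) = c v ∧ pos (nb (kp v) v) < pos v)
    (hk : ∀ v, (kn v = k1 ∧ kp v = k2) ∨ (kn v = k2 ∧ kp v = k1)) :
    2 * (V.image c).card ≤ bdc V k1 + bdc V k2 := by
  have h1 := strip_count_aux V c pos kn hn
  have h2 := strip_count_aux V c (fun v => - pos v) kp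
    (fun v => ⟨(hp v).1, by have := (hp v).2; omega⟩)
  have h3 : (V.filter (fun v => nb (kn v) v ∉ V)).card + (V.filter (fun v => nb (kp v) v ∉ V)).card
      = bdc V k1 + bdc V k2 := by
    unfold bdc
    simp only [Finset.card_filter]
    rw [← Finset.sum_add_distrib, ← Finset.sum_add_distrib]
    refine Finset.sum_congr rfl fun v _ => ?_
    rcases hk v with ⟨e1, e2⟩ | ⟨e1, e2⟩
    · rw [e1, e2]
    · rw [e1, e2, add_comm]
  omega

lemma bdc_lower (V : Finset Pl) :
    (V.image (crd 1)).card + (V.image (crd 0)).card + (V.image (crd 2)).card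
      ≤ bdc V 0 + bdc V 1 + bdc V 2 := by
  have h0 := strip_count V (crd 0) (fun v => 2 * v.1.1 + (if v.2 = true then 1 else 0))
    (fun v => if v.2 = true then 1 else 0) (fun v => if v.2 = true then 0 else 1) 0 1
    (by rintro ⟨⟨i, j⟩, _ | _⟩ <;> simp [crd, nb] <;> omega)
    (by rintro ⟨⟨i, j⟩, _ | _⟩ <;> simp [crd, nb] <;> omega)
    (by rintro ⟨⟨i, j⟩, _ | _⟩ <;> simp)
  have h1 := strip_count V (crd 1) (fun v => 2 * v.1.2 + (if v.2 = true then 1 else 0))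
    (fun v => if v.2 = true then 2 else 0) (fun v => if v.2 = true then 0 else 2) 0 2
    (by rintro ⟨⟨i, j⟩, _ | _⟩ <;> simp [crd, nb] <;> omega)
    (by rintro ⟨⟨i, j⟩, _ | _⟩ <;> simp [crd, nb] <;> omega)
    (by rintro ⟨⟨i, j⟩, _ | _⟩ <;> simp)
  have h2 := strip_count V (crd 2) (fun v => 2 * v.1.1 + (if v.2 = true then 1 else 0))
    (fun v => if v.2 = true then 1 else 2) (fun v => if v.2 = true then 2 else 1) 1 2
    (by rintro ⟨⟨i, j⟩, _ | _⟩ <;> simp [crd, nb] <;> omega)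
    (by rintro ⟨⟨i, j⟩, _ | _⟩ <;> simp [crd, nb] <;> omega)
    (by rintro ⟨⟨i, j⟩, _ | _⟩ <;> simp)
  omega

lemma card_le_pairN (V : Finset Pl) :
    V.card ≤ pairN (V.image (crd 1)) (V.image (crd 0)) (V.image (crd 2)) +
      pairN (V.image (crd 1)) (V.image (crd 0)) ((V.image (crd 2)).image (fun z => z - 1)) := by
  have hs := Finset.card_filter_add_card_filter_not (s := V) (fun v => v.2 = false)
  have h1 : (V.filter (fun v => v.2 = false)).card ≤
      pairN (V.image (crd 1)) (V.image (crd 0)) (V.image (crd 2)) := by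
    refine Finset.card_le_card_of_injOn (fun v => v.1) ?_ ?_
    · intro v hv
      have hv := Finset.mem_filter.1 hv
      refine Finset.mem_coe.2 (Finset.mem_filter.2 ⟨Finset.mem_product.2
        ⟨Finset.mem_image.2 ⟨v, hv.1, by simp [crd]⟩, Finset.mem_image.2 ⟨v, hv.1, by simp [crd]⟩⟩,
        Finset.mem_image.2 ⟨v, hv.1, by simp [crd, hv.2]⟩⟩)
    · intro v hv w hw h
      have hv := (Finset.mem_filter.1 hv).2
      have hw := (Finset.mem_filter.1 hw).2
      exact Prod.ext h (hv.trans hw.symm)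
  have h2 : (V.filter (fun v => ¬ v.2 = false)).card ≤
      pairN (V.image (crd 1)) (V.image (crd 0)) ((V.image (crd 2)).image (fun z => z - 1)) := by
    refine Finset.card_le_card_of_injOn (fun v => v.1) ?_ ?_
    · intro v hv
      have hv := Finset.mem_filter.1 hv
      have hv2 : v.2 = true := by simpa using hv.2
      refine Finset.mem_coe.2 (Finset.mem_filter.2 ⟨Finset.mem_product.2
        ⟨Finset.mem_image.2 ⟨v, hv.1, by simp [crd]⟩, Finset.mem_image.2 ⟨v, hv.1, by simp [crd]⟩⟩,
        Finset.mem_image.2 ⟨crd 2 v, Finset.mem_image_of_mem _ hv.1, by simp [crd, hv2]⟩⟩)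
    · intro v hv w hw h
      have hv : v.2 = true := by simpa using (Finset.mem_filter.1 hv).2
      have hw : w.2 = true := by simpa using (Finset.mem_filter.1 hw).2
      exact Prod.ext h (hv.trans hw.symm)
  omega

/-- Planar isoperimetric inequality for finite sets of triangles. -/
lemma planar_isop (V : Finset Pl) : 6 * V.card ≤ (bdc V 0 + bdc V 1 + bdc V 2) ^ 2 := by
  have h1 := card_le_pairN V
  have h2 := pairN_isop (V.image (crd 1)) (V.image (crd 0)) (V.image (crd 2)) _ rfl
  have h3 := Nat.pow_le_pow_left (bdc_lower V) 2
  omega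

/-- Projection of the plane to the torus. -/
def proj (L : ℕ) (v : Pl) : Site L := (((v.1.1 : ZMod L), (v.1.2 : ZMod L)), v.2)

/-- Strip index on the torus. -/
def sidx (L : ℕ) (d : Fin 3) (v : Site L) : ZMod L :=
  if d = 0 then v.1.2
  else if d = 1 then v.1.1
  else v.1.1 + v.1.2 + (if v.2 = true then 1 else 0)

lemma mem_strip (L : ℕ) (d : Fin 3) (l : ZMod L) (v : Site L) :
    v ∈ stripSet L d l ↔ sidx L d v = l := by
  obtain ⟨⟨x, y⟩, s⟩ := v
  unfold stripSet sidx
  fin_cases d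
  · simp
  · simp
  · cases s <;> simp [eq_sub_iff_add_eq]

lemma sidx_proj (L : ℕ) (d : Fin 3) (v : Pl) : sidx L d (proj L v) = (crd d v : ZMod L) := by
  obtain ⟨⟨x, y⟩, s⟩ := v
  fin_cases d <;> cases s <;> simp [sidx, crd, proj]

lemma proj_unique (L : ℕ) (d d' : Fin 3) (hd : d ≠ d') (k k' : ℤ) (v w : Pl)
    (h : proj L v = proj L w)
    (h1 : k ≤ crd d v ∧ crd d v < k + L) (h2 : k ≤ crd d w ∧ crd d w < k + L)
    (h3 : k' ≤ crd d' v ∧ crd d' v < k' + L) (h4 : k' ≤ crd d' w ∧ crd d' w < k' + L) :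
    v = w := by
  have gen : ∀ (e : Fin 3) (m : ℤ), m ≤ crd e v ∧ crd e v < m + L →
      m ≤ crd e w ∧ crd e w < m + L → crd e v = crd e w := by
    intro e m g1 g2
    have : ((crd e v : ℤ) : ZMod L) = (crd e w : ℤ) := by rw [← sidx_proj, ← sidx_proj, h]
    have hdvd := (ZMod.intCast_eq_intCast_iff_dvd_sub _ _ _).1 this
    have := Int.eq_zero_of_abs_lt_dvd hdvd (by rw [abs_lt]; constructor <;> omega)
    omega
  have e1 := gen d k h1 h2
  have e2 := gen d' k' h3 h4
  have e3 : v.2 = w.2 := congrArg (fun u : Site L => u.2) h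
  obtain ⟨⟨x, y⟩, s⟩ := v
  obtain ⟨⟨x', y'⟩, s'⟩ := w
  simp only at e3
  subst e3
  fin_cases d <;> fin_cases d' <;> simp_all [crd] <;> omega

lemma exists_lift (L : ℕ) [NeZero L] (r : ZMod L) (k : ℤ) :
    ∃ n : ℤ, (n : ZMod L) = r ∧ k ≤ n ∧ n < k + L := by
  refine ⟨k + ((r - (k : ZMod L)).val : ℤ), ?_, by omega, ?_⟩
  · push_cast
    simp
  · have := ZMod.val_lt (r - (k : ZMod L))
    omega

lemma exists_section (L : ℕ) [NeZero L] (d d' : Fin 3) (hd : d ≠ d') (k k' : ℤ) (u : Site L) :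
    ∃ v : Pl, proj L v = u ∧ (k ≤ crd d v ∧ crd d v < k + L) ∧
      (k' ≤ crd d' v ∧ crd d' v < k' + L) := by
  obtain ⟨n, hn, hn'⟩ := exists_lift L (sidx L d u) k
  obtain ⟨m, hm, hm'⟩ := exists_lift L (sidx L d' u) k'
  obtain ⟨v, hv, hv'⟩ : ∃ v : Pl, proj L v = u ∧ crd d v = n ∧ crd d' v = m := by
    clear hn' hm'
    obtain ⟨⟨x, y⟩, s⟩ := u
    set e : ℤ := if s = true then 1 else 0 with he
    have he' : (e : ZMod L) = if s = true then 1 else 0 := by rw [he]; split_ifs <;> simp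
    have c01 : ∀ p q : ℤ, (q : ZMod L) = x → (p : ZMod L) = y → proj L ((q, p), s) = ((x, y), s) := by
      intro p q h1 h2; simp [proj, h1, h2]
    fin_cases d <;> fin_cases d' <;> simp [sidx] at hn hm hd
    · exact ⟨((m, n), s), c01 _ _ hm hn, by simp [crd]⟩
    · exact ⟨((m - n - e, n), s), c01 _ _ (by push_cast; rw [hm, hn, he']; ring) hn,
        by cases s <;> simp [crd, he] <;> ring⟩
    · exact ⟨((n, m), s), c01 _ _ hn hm, by simp [crd]⟩
    · exact ⟨((n, m - n - e), s), c01 _ _ hn (by push_cast; rw [hm, hn, he']; ring),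
        by cases s <;> simp [crd, he] <;> ring⟩
    · exact ⟨((n - m - e, m), s), c01 _ _ (by push_cast; rw [hm, hn, he']; ring) hm,
        by cases s <;> simp [crd, he] <;> ring⟩
    · exact ⟨((m, n - m - e), s), c01 _ _ hm (by push_cast; rw [hm, hn, he']; ring),
        by cases s <;> simp [crd, he] <;> ring⟩
  exact ⟨v, hv, by omega, by omega⟩

lemma crd_nb (d k : Fin 3) (v : Pl) : crd d v - 1 ≤ crd d (nb k v) ∧ crd d (nb k v) ≤ crd d v + 1 := by
  obtain ⟨⟨x, y⟩, s⟩ := v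
  fin_cases d <;> fin_cases k <;> cases s <;> simp [crd, nb] <;> omega

lemma nb_snd (k : Fin 3) (v : Pl) : (nb k v).2 = !v.2 := by
  obtain ⟨⟨x, y⟩, s⟩ := v
  fin_cases k <;> cases s <;> simp [nb]

lemma hexAdj_nb (L : ℕ) (k : Fin 3) (v : Pl) : hexAdj (proj L v) (proj L (nb k v)) := by
  obtain ⟨⟨x, y⟩, s⟩ := v
  fin_cases k <;> cases s <;> simp [hexAdj, proj, nb]

lemma hexAdj_symm {L : ℕ} {v w : Site L} (h : hexAdj v w) : hexAdj w v := by
  unfold hexAdj at *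
  tauto

lemma nb_inj (L : ℕ) (hL : 8 ≤ L) (k k' : Fin 3) (v : Pl)
    (h : proj L (nb k v) = proj L (nb k' v)) : k = k' := by
  have : Fact (1 < L) := ⟨by omega⟩
  obtain ⟨⟨x, y⟩, s⟩ := v
  fin_cases k <;> fin_cases k' <;> cases s <;> simp [proj, nb] at h ⊢ <;>
    (rw [eq_comm, sub_eq_self] at h; exact one_ne_zero h)

/-- Lemma 9.4 (hexagonal lattice): if `σ` has an `a`-cross then
`Σ_{b ≠ a} ‖σ‖_b ≤ H(σ)²/6`. -/
theorem cross_isoperimetry (L q : ℕ) (hL : 8 ≤ L) (hq : 2 ≤ q) (σ : Conf L q)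
    (a : Fin q) (h : HasCross L q σ a) :
    ((∑ b ∈ Finset.univ.erase a, spinCount L q σ b : ℕ) : ℝ) ≤
      (Ham L q σ : ℝ) ^ 2 / 6 := by
  have : NeZero L := ⟨by omega⟩
  obtain ⟨d, d', l, l', hd, hb, hb'⟩ := h
  set U : Finset (Site L) := Finset.univ.filter (fun u => σ u ≠ a) with hU
  have hUmem : ∀ u, u ∈ U ↔ σ u ≠ a := fun u => by simp [hU]
  have hsum : ∑ b ∈ Finset.univ.erase a, spinCount L q σ b = U.card := by
    have : ∀ b, spinCount L q σ b = (Finset.univ.filter (fun u => σ u = b)).card := by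
      intro b
      unfold spinCount
      rw [Nat.card_eq_fintype_card, Fintype.card_subtype]
    simp only [this]
    rw [Finset.card_eq_sum_card_fiberwise (f := σ) (t := Finset.univ.erase a)]
    · refine Finset.sum_congr rfl fun b hb => ?_
      congr 1
      ext u
      have : b ≠ a := Finset.ne_of_mem_erase hb
      simp only [hU, Finset.mem_filter, Finset.mem_univ, true_and]
      constructor
      · rintro rfl; exact ⟨this, rfl⟩
      · exact fun h => h.2
    · intro u hu
      simpa using (hUmem u).1 hu
  set K : ℤ := (l.val : ℤ) with hK
  set K' : ℤ := (l'.val : ℤ) with hK'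
  have hKl : (K : ZMod L) = l := by simp [hK]
  have hKl' : (K' : ZMod L) = l' := by simp [hK']
  choose ψ hψ1 hψ2 hψ3 using exists_section L d d' hd K K'
  have hψinj : Function.Injective ψ := fun u w h => by rw [← hψ1 u, h, hψ1]
  set V : Finset Pl := U.image ψ with hV
  have hVc : V.card = U.card := Finset.card_image_of_injective _ hψinj
  have hVU : ∀ v ∈ V, proj L v ∈ U ∧ ψ (proj L v) = v := by
    intro v hv
    obtain ⟨u, hu, rfl⟩ := Finset.mem_image.1 hv
    rw [hψ1]; exact ⟨hu, rfl⟩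
  have off : ∀ w : Pl, proj L w ∈ U → (crd d w ≠ K ∧ crd d w ≠ K + L) ∧
      (crd d' w ≠ K' ∧ crd d' w ≠ K' + L) := by
    intro w hw
    rw [hUmem] at hw
    refine ⟨⟨fun h => hw (hb _ ?_), fun h => hw (hb _ ?_)⟩,
      ⟨fun h => hw (hb' _ ?_), fun h => hw (hb' _ ?_)⟩⟩ <;>
    · rw [mem_strip, sidx_proj, h]
      simp [hKl, hKl']
  have hout : ∀ v ∈ V, ∀ k, nb k v ∉ V → proj L (nb k v) ∉ U := by
    intro v hv k hk hin
    apply hk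
    have o1 := off _ hin
    have o2 := off _ (hVU v hv).1
    have r1 := hψ2 (proj L v)
    have r2 := hψ3 (proj L v)
    rw [(hVU v hv).2] at r1 r2
    have c1 := crd_nb d k v
    have c2 := crd_nb d' k v
    have : nb k v = ψ (proj L (nb k v)) := by
      refine proj_unique L d d' hd K K' _ _ (hψ1 _).symm ?_ (hψ2 _) ?_ (hψ3 _) <;> omega
    rw [this]
    exact Finset.mem_image_of_mem _ hin
  have hHam : bdc V 0 + bdc V 1 + bdc V 2 ≤ Ham L q σ := by
    have hH : Ham L q σ = (Finset.univ.filter (fun e : Site L × Site L =>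
        e.1.2 = false ∧ hexAdj e.1 e.2 ∧ σ e.1 ≠ σ e.2)).card := by
      unfold Ham
      rw [Nat.card_eq_fintype_card, Fintype.card_subtype]
    have hT : bdc V 0 + bdc V 1 + bdc V 2 =
        ((Finset.univ ×ˢ V : Finset (Fin 3 × Pl)).filter (fun p => nb p.1 p.2 ∉ V)).card := by
      rw [Finset.card_filter, Finset.sum_product, Fin.sum_univ_three]
      simp only [bdc, Finset.card_filter]
    rw [hH, hT]
    have hm : ∀ p ∈ ((Finset.univ ×ˢ V : Finset (Fin 3 × Pl)).filter (fun p => nb p.1 p.2 ∉ V)),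
        p.2 ∈ V ∧ proj L p.2 ∈ U ∧ proj L (nb p.1 p.2) ∉ U := by
      intro p hp
      simp only [Finset.mem_filter, Finset.mem_product, Finset.mem_univ, true_and] at hp
      exact ⟨hp.1, (hVU _ hp.1).1, hout _ hp.1 _ hp.2⟩
    refine Finset.card_le_card_of_injOn (fun p => if p.2.2 = false then
      (proj L p.2, proj L (nb p.1 p.2)) else (proj L (nb p.1 p.2), proj L p.2)) ?_ ?_
    · intro p hp
      obtain ⟨m1, m2, m3⟩ := hm p hp
      have hne : σ (proj L p.2) ≠ σ (proj L (nb p.1 p.2)) := by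
        rw [hUmem] at m2 m3
        push Not at m3
        rw [m3]; exact m2
      simp only [Finset.coe_filter, Finset.mem_univ, true_and, Set.mem_ofPred_eq]
      by_cases hs : p.2.2 = false
      · simp only [hs, if_true]
        exact ⟨hs, hexAdj_nb _ _ _, hne⟩
      · simp only [hs, if_false]
        refine ⟨?_, hexAdj_symm (hexAdj_nb _ _ _), hne.symm⟩
        show (nb p.1 p.2).2 = false
        rw [nb_snd]; simpa using hs
    · intro p hp p' hp' h
      obtain ⟨m1, m2, m3⟩ := hm p hp
      obtain ⟨n1, n2, n3⟩ := hm p' hp'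
      have fin : proj L p.2 = proj L p'.2 → proj L (nb p.1 p.2) = proj L (nb p'.1 p'.2) → p = p' := by
        intro e1 e2
        have e3 : p.2 = p'.2 := by rw [← (hVU _ m1).2, ← (hVU _ n1).2, e1]
        rw [← e3] at e2
        exact Prod.ext (nb_inj L hL _ _ _ e2) e3
      by_cases hs : p.2.2 = false <;> by_cases hs' : p'.2.2 = false <;>
        simp only [hs, hs', if_true, Bool.true_eq_false, if_false, Prod.mk.injEq] at h
      · exact fin h.1 h.2
      · exact absurd (h.1 ▸ m2) n3
      · exact absurd (h.2 ▸ m2) n3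
      · exact fin h.2 h.1
  have h1 := planar_isop V
  have h2 := Nat.pow_le_pow_left hHam 2
  rw [hsum, le_div_iff₀ (by norm_num)]
  have h3 : U.card * 6 ≤ Ham L q σ ^ 2 := by rw [← hVc]; omega
  exact_mod_cast h3

end IsingHex
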